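/- arXiv:0906.4316 — 2 statements merged into one kernel-verified Lean document; each statement's English description precedes it below -/
import Mathlib

section
/- A binary relation ⪰ on a closed, mixture-closed set C of Anscombe–Aumann acts is complete, satisfies extended mixture cancellation, and has closed graph if and only if there exists a single function u : S × O → ℝ such that for all a, b ∈ C: a ⪰ b if and only if ∑_{s∈S} ∑_{o∈O} u(s,o)·a(s)(o) ≥ ∑_{s∈S} ∑_{o∈O} u(s,o)·b(s)(o). -/
/-- An Anscombe–Aumann act: a map assigning to each state a probability vector over outcomes. -/
def IsAAAct {S O : Type*} [Fintype O] (a : S → O → ℝ) : Prop :=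
  ∀ s, (∀ o, 0 ≤ a s o) ∧ (∑ o, a s o = 1)

/-- Extended mixture cancellation for a relation on a subset of a real vector space. -/
def ExtMixCancel {V : Type*} [AddCommGroup V] [Module ℝ V]
    (C : Set V) (R : V → V → Prop) : Prop :=
  ∀ (n : ℕ) (a b : Fin (n + 1) → V),
    (∀ i, a i ∈ C) → (∀ i, b i ∈ C) →
    (∑ i, a i = ∑ i, b i) →
    (∃ k, k ≤ n ∧ (∀ i : Fin (n + 1), (i : ℕ) < k → R (a i) (b i)) ∧
      (∀ i : Fin (n + 1), k ≤ (i : ℕ) → a i = a (Fin.last n) ∧ b i = b (Fin.last n))) →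
    R (b (Fin.last n)) (a (Fin.last n))

/-- The graph `{(a, b) ∈ C × C : a ⪰ b}` is closed. -/
def ClosedGraphOn {V : Type*} [TopologicalSpace V] (C : Set V) (R : V → V → Prop) : Prop :=
  IsClosed {p : V × V | p.1 ∈ C ∧ p.2 ∈ C ∧ R p.1 p.2}

lemma aux_mid_closed (T : Set ℝ) (hT : IsClosed T) (h0 : (0:ℝ) ∈ T) (h1 : (1:ℝ) ∈ T)
    (hm : ∀ x ∈ T, ∀ y ∈ T, (x + y) / 2 ∈ T) (x : ℝ) (hx0 : 0 ≤ x) (hx1 : x ≤ 1) : x ∈ T := by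
  have hbA : BddAbove (T ∩ Set.Iic x) := ⟨x, fun y hy => hy.2⟩
  have hbB : BddBelow (T ∩ Set.Ici x) := ⟨x, fun y hy => hy.2⟩
  have hA := (hT.inter isClosed_Iic).csSup_mem ⟨0, h0, hx0⟩ hbA
  have hB := (hT.inter isClosed_Ici).csInf_mem ⟨1, h1, hx1⟩ hbB
  set y := sSup (T ∩ Set.Iic x) with hy
  set z := sInf (T ∩ Set.Ici x) with hz
  have hyx : y ≤ x := hA.2
  have hxz : x ≤ z := hB.2
  have hmm := hm y hA.1 z hB.1
  rcases le_total ((y + z) / 2) x with h | h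
  · have : (y + z) / 2 ≤ y := le_csSup hbA ⟨hmm, h⟩
    have : x = y := by linarith
    rw [this]; exact hA.1
  · have : z ≤ (y + z) / 2 := csInf_le hbB ⟨hmm, h⟩
    have : x = z := by linarith
    rw [this]; exact hB.1

section aux
variable {V : Type*} [AddCommGroup V] [Module ℝ V]

lemma aux_refl {C : Set V} {R : V → V → Prop} (hE : ExtMixCancel C R) {a : V} (ha : a ∈ C) :
    R a a := by
  have := hE 0 (fun _ => a) (fun _ => a) (fun _ => ha) (fun _ => ha) rfl
    ⟨0, le_rfl, fun i hi => absurd hi (by omega), fun i _ => ⟨rfl, rfl⟩⟩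
  exact this

lemma aux_diff {C : Set V} {R : V → V → Prop} (hE : ExtMixCancel C R) {a b c d : V}
    (ha : a ∈ C) (hb : b ∈ C) (hc : c ∈ C) (hd : d ∈ C) (h : a - b = c - d) (hR : R a b) :
    R c d := by
  have := hE 1 ![a, d] ![b, c] (by intro i; fin_cases i <;> simpa)
    (by intro i; fin_cases i <;> simpa)
    (by
      have e : a + d = b + c := by
        rw [sub_eq_sub_iff_add_eq_add] at h; rw [h]; abel
      exact (Fin.sum_univ_two _).trans (e.trans (Fin.sum_univ_two ![b, c]).symm))
    ⟨1, le_rfl, by intro i hi; fin_cases i <;> simp_all,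
      by intro i hi; fin_cases i <;> simp_all [Fin.last]⟩
  exact this

lemma aux_mid {C : Set V} {R : V → V → Prop} (hE : ExtMixCancel C R) {a b c d m m' : V}
    (ha : a ∈ C) (hb : b ∈ C) (hc : c ∈ C) (hd : d ∈ C) (hm : m ∈ C) (hm' : m' ∈ C)
    (h : a + c = m + m) (h' : b + d = m' + m') (hR : R a b) (hR' : R c d) :
    R m m' := by
  have := hE 3 ![a, c, m', m'] ![b, d, m, m] (by intro i; fin_cases i <;> simpa)
    (by intro i; fin_cases i <;> simpa)
    (by
      have e : a + c + m' + m' = b + d + m + m := by rw [h, h']; abel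
      exact (Fin.sum_univ_four _).trans (e.trans (Fin.sum_univ_four ![b, d, m, m]).symm))
    ⟨2, by norm_num, by intro i hi; fin_cases i <;> simp_all,
      by intro i hi; fin_cases i <;> simp_all [Fin.last]⟩
  exact this

lemma aux_half {C : Set V} {R : V → V → Prop} (hE : ExtMixCancel C R) {a b m : V}
    (ha : a ∈ C) (hb : b ∈ C) (hm : m ∈ C)
    (h : m + m = a + b) (hR : R m b) :
    R a b := by
  have := hE 2 ![m, m, b] ![b, b, a] (by intro i; fin_cases i <;> simpa)
    (by intro i; fin_cases i <;> simpa)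
    (by
      have e : m + m + b = b + b + a := by rw [h]; abel
      exact (Fin.sum_univ_three _).trans (e.trans (Fin.sum_univ_three ![b, b, a]).symm))
    ⟨2, by norm_num, by intro i hi; fin_cases i <;> simp_all,
      by intro i hi; fin_cases i <;> simp_all [Fin.last]⟩
  exact this

lemma aux_halfpow {C : Set V} {R : V → V → Prop} (hE : ExtMixCancel C R)
    (hmix : ∀ a ∈ C, ∀ b ∈ C, ∀ r : ℝ, 0 ≤ r → r ≤ 1 → r • a + (1 - r) • b ∈ C)
    {a b : V} (ha : a ∈ C) (hb : b ∈ C) (n : ℕ)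
    (hR : R (((1/2:ℝ)^n) • a + (1 - (1/2:ℝ)^n) • b) b) : R a b := by
  induction n with
  | zero => simpa using hR
  | succ n ih =>
    have key : ∀ n : ℕ, ((1/2:ℝ)^n) • a + (1 - (1/2:ℝ)^n) • b ∈ C := fun n =>
      hmix a ha b hb _ (by positivity) (pow_le_one₀ (by norm_num) (by norm_num))
    refine ih (aux_half hE (key n) hb (key (n+1)) ?_ hR)
    rw [pow_succ]
    module

lemma aux_conv_emc {C : Set V} {R : V → V → Prop} (G : V →ₗ[ℝ] ℝ)
    (h : ∀ a ∈ C, ∀ b ∈ C, (R a b ↔ G b ≤ G a)) : ExtMixCancel C R := by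
  rintro n a b ha hb hsum ⟨k, hk, h1, h2⟩
  rw [h _ (hb _) _ (ha _)]
  by_contra! hlt
  have hs : ∑ i, G (a i) = ∑ i, G (b i) := by rw [← map_sum, ← map_sum, hsum]
  refine absurd hs (ne_of_gt (Finset.sum_lt_sum (fun i _ => ?_) ⟨Fin.last n, Finset.mem_univ _, hlt⟩))
  rcases lt_or_ge (i : ℕ) k with hi | hi
  · exact (h _ (ha _) _ (hb _)).1 (h1 i hi)
  · rw [(h2 i hi).1, (h2 i hi).2]; exact hlt.le

variable [TopologicalSpace V] [IsTopologicalAddGroup V] [ContinuousSMul ℝ V]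

lemma aux_mix {C : Set V} {R : V → V → Prop} (hE : ExtMixCancel C R) (hG : ClosedGraphOn C R)
    (hmix : ∀ a ∈ C, ∀ b ∈ C, ∀ r : ℝ, 0 ≤ r → r ≤ 1 → r • a + (1 - r) • b ∈ C)
    {a b c d : V} (ha : a ∈ C) (hb : b ∈ C) (hc : c ∈ C) (hd : d ∈ C)
    (hR : R a b) (hR' : R c d) {r : ℝ} (h0 : 0 ≤ r) (h1 : r ≤ 1) :
    R (r • a + (1 - r) • c) (r • b + (1 - r) • d) := by
  let φ : ℝ → V × V := fun r => (r • a + (1 - r) • c, r • b + (1 - r) • d)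
  have hφ : Continuous φ := by fun_prop
  have hT : IsClosed (φ ⁻¹' {p : V × V | p.1 ∈ C ∧ p.2 ∈ C ∧ R p.1 p.2}) := hG.preimage hφ
  refine (aux_mid_closed _ hT ?_ ?_ ?_ r h0 h1).2.2
  · simp [φ, hc, hd, hR']
  · simp [φ, ha, hb, hR]
  · rintro x ⟨hx1, hx2, hx3⟩ y ⟨hy1, hy2, hy3⟩
    have e : ∀ a c : V, ((x + y) / 2) • a + (1 - (x + y) / 2) • c =
      (1/2 : ℝ) • (x • a + (1 - x) • c) + (1 - 1/2 : ℝ) • (y • a + (1 - y) • c) := by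
      intro a c; module
    have m1 : (φ ((x + y) / 2)).1 ∈ C := by
      simp only [φ]; rw [e]; exact hmix _ hx1 _ hy1 _ (by norm_num) (by norm_num)
    have m2 : (φ ((x + y) / 2)).2 ∈ C := by
      simp only [φ]; rw [e]; exact hmix _ hx2 _ hy2 _ (by norm_num) (by norm_num)
    refine ⟨m1, m2, aux_mid hE hx1 hx2 hy1 hy2 m1 m2 ?_ ?_ hx3 hy3⟩ <;>
    · simp only [φ]; module

/-- invariance under positive scaling of differences -/
lemma aux_scale {C : Set V} {R : V → V → Prop} (hE : ExtMixCancel C R) (hG : ClosedGraphOn C R)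
    (hmix : ∀ a ∈ C, ∀ b ∈ C, ∀ r : ℝ, 0 ≤ r → r ≤ 1 → r • a + (1 - r) • b ∈ C)
    {a b c d : V} (ha : a ∈ C) (hb : b ∈ C) (hc : c ∈ C) (hd : d ∈ C) {k : ℝ} (hk : 0 ≤ k)
    (h : c - d = k • (a - b)) (hR : R a b) : R c d := by
  -- choose n with 2^-n * k ≤ 1
  obtain ⟨n, hn⟩ : ∃ n : ℕ, (1/2:ℝ)^n * k ≤ 1 := by
    obtain ⟨n, hn⟩ := exists_pow_lt_of_lt_one (show (0:ℝ) < 1 / (k + 1) by positivity)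
      (show (1/2:ℝ) < 1 by norm_num)
    refine ⟨n, ?_⟩
    have : (1/2:ℝ)^n * (k + 1) < 1 := (lt_div_iff₀ (by positivity)).1 hn
    have : (0:ℝ) < (1/2:ℝ)^n := by positivity
    nlinarith
  refine aux_halfpow hE hmix hc hd n ?_
  have hr0 : 0 ≤ (1/2:ℝ)^n * k := by positivity
  have h1 := aux_mix hE hG hmix ha hb hb hb hR (aux_refl hE hb) hr0 hn
  refine aux_diff hE (hmix a ha b hb _ hr0 hn) (hmix b hb b hb _ hr0 hn)
    (hmix c hc d hd _ (by positivity) (pow_le_one₀ (by norm_num) (by norm_num))) hd ?_ h1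
  have : ((1/2:ℝ)^n) • c + (1 - (1/2:ℝ)^n) • d - d = ((1/2:ℝ)^n) • (c - d) := by module
  rw [this, h]; module

lemma aux_arch {C : Set V} {R : V → V → Prop} (hG : ClosedGraphOn C R)
    (hcomp : ∀ a ∈ C, ∀ b ∈ C, R a b ∨ R b a)
    (hmix : ∀ a ∈ C, ∀ b ∈ C, ∀ r : ℝ, 0 ≤ r → r ≤ 1 → r • a + (1 - r) • b ∈ C)
    {p q a b : V} (hp : p ∈ C) (hq : q ∈ C) (ha : a ∈ C) (hb : b ∈ C) (hpq : ¬ R q p) :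
    ∃ r : ℝ, 0 < r ∧ r < 1 ∧ R (r • a + (1 - r) • p) (r • b + (1 - r) • q) := by
  by_contra! hcon
  let φ : ℝ → V × V := fun r => (r • b + (1 - r) • q, r • a + (1 - r) • p)
  have hφ : Continuous φ := by fun_prop
  have hT : IsClosed (φ ⁻¹' {p : V × V | p.1 ∈ C ∧ p.2 ∈ C ∧ R p.1 p.2}) := hG.preimage hφ
  have hsub : Set.Ioo (0:ℝ) 1 ⊆ φ ⁻¹' {p : V × V | p.1 ∈ C ∧ p.2 ∈ C ∧ R p.1 p.2} := by
    rintro r ⟨h0, h1⟩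
    have m1 := hmix a ha p hp r h0.le h1.le
    have m2 := hmix b hb q hq r h0.le h1.le
    exact ⟨m2, m1, (hcomp _ m1 _ m2).resolve_left (hcon r h0 h1)⟩
  have h0 := hT.closure_subset_iff.2 hsub
  rw [closure_Ioo (by norm_num)] at h0
  have := (h0 (show (0:ℝ) ∈ Set.Icc 0 1 by simp)).2.2
  simp [φ] at this
  exact hpq this

lemma aux_comb (t s : ℝ) (ht : 0 ≤ t) (hs : 0 ≤ s) (a b c d : V) :
    ∃ r : ℝ, 0 ≤ r ∧ r ≤ 1 ∧ t • (a - b) + s • (c - d) =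
      (t + s) • ((r • a + (1 - r) • c) - (r • b + (1 - r) • d)) := by
  rcases (add_nonneg ht hs).eq_or_lt with h | h
  · have h1 : t = 0 := by linarith
    have h2 : s = 0 := by linarith
    exact ⟨0, le_rfl, zero_le_one, by simp [h1, h2]⟩
  · refine ⟨t / (t + s), by positivity, (div_le_one h).2 (by linarith), ?_⟩
    have e1 : t = (t + s) * (t / (t + s)) := by field_simp
    have e2 : s = (t + s) * (1 - t / (t + s)) := by field_simp; ring
    generalize t / (t + s) = r at *
    have : (t + s) • ((r • a + (1 - r) • c) - (r • b + (1 - r) • d)) =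
      ((t + s) * r) • (a - b) + ((t + s) * (1 - r)) • (c - d) := by module
    rw [this, ← e1, ← e2]

lemma aux_main {C : Set V} {R : V → V → Prop} (hE : ExtMixCancel C R) (hG : ClosedGraphOn C R)
    (hcomp : ∀ a ∈ C, ∀ b ∈ C, R a b ∨ R b a)
    (hmix : ∀ a ∈ C, ∀ b ∈ C, ∀ r : ℝ, 0 ≤ r → r ≤ 1 → r • a + (1 - r) • b ∈ C) :
    ∃ G : V →ₗ[ℝ] ℝ, ∀ a ∈ C, ∀ b ∈ C, (R a b ↔ G b ≤ G a) := by
  by_cases htriv : ∀ a ∈ C, ∀ b ∈ C, R a b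
  · exact ⟨0, fun a ha b hb => by simp [htriv a ha b hb]⟩
  push Not at htriv
  obtain ⟨q, hq, p, hp, hqp⟩ := htriv
  let W : Submodule ℝ V :=
    { carrier := {v | ∃ t : ℝ, 0 ≤ t ∧ ∃ a ∈ C, ∃ b ∈ C, v = t • (a - b)}
      zero_mem' := ⟨0, le_rfl, p, hp, p, hp, by simp⟩
      add_mem' := by
        rintro _ _ ⟨t, ht, a, ha, b, hb, rfl⟩ ⟨s, hs, c, hc, d, hd, rfl⟩
        obtain ⟨r, h0, h1, h⟩ := aux_comb t s ht hs a b c d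
        exact ⟨t + s, by positivity, _, hmix a ha c hc r h0 h1, _, hmix b hb d hd r h0 h1, h⟩
      smul_mem' := by
        rintro k _ ⟨t, ht, a, ha, b, hb, rfl⟩
        rcases le_total 0 k with hk | hk
        · exact ⟨k * t, by positivity, a, ha, b, hb, by module⟩
        · exact ⟨(-k) * t, mul_nonneg (by linarith) ht, b, hb, a, ha, by module⟩ }
  let P : PointedCone ℝ V :=
    { carrier := {v | ∃ t : ℝ, 0 ≤ t ∧ ∃ a ∈ C, ∃ b ∈ C, R a b ∧ v = t • (a - b)}
      zero_mem' := ⟨0, le_rfl, p, hp, p, hp, aux_refl hE hp, by simp⟩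
      add_mem' := by
        rintro _ _ ⟨t, ht, a, ha, b, hb, hab, rfl⟩ ⟨s, hs, c, hc, d, hd, hcd, rfl⟩
        obtain ⟨r, h0, h1, h⟩ := aux_comb t s ht hs a b c d
        exact ⟨t + s, by positivity, _, hmix a ha c hc r h0 h1, _, hmix b hb d hd r h0 h1,
          aux_mix hE hG hmix ha hb hc hd hab hcd h0 h1, h⟩
      smul_mem' := by
        rintro ⟨k, hk⟩ _ ⟨t, ht, a, ha, b, hb, hab, rfl⟩
        exact ⟨k * t, mul_nonneg hk ht, a, ha, b, hb, hab, by
          rw [mul_smul]; rfl⟩ }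
  have hWd : ∀ a ∈ C, ∀ b ∈ C, a - b ∈ W := fun a ha b hb =>
    ⟨1, zero_le_one, a, ha, b, hb, by simp⟩
  have hPd : ∀ a ∈ C, ∀ b ∈ C, R a b → a - b ∈ P := fun a ha b hb h =>
    ⟨1, zero_le_one, a, ha, b, hb, h, by simp⟩
  have hpq0 : p - q ≠ 0 := fun h => hqp (by
    rw [sub_eq_zero] at h; rw [← h]; exact aux_refl hE hp)
  let e : W := ⟨p - q, hWd p hp q hq⟩
  have he : e ≠ 0 := fun h => hpq0 (congrArg Subtype.val h)
  obtain ⟨g, hg1, hg2⟩ := riesz_extension (PointedCone.comap W.subtype P)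
    (LinearPMap.mkSpanSingleton (σ := RingHom.id ℝ) e (1:ℝ) he) (by
      rintro ⟨x, hx⟩ hxP
      obtain ⟨t, rfl⟩ := Submodule.mem_span_singleton.1 hx
      rw [LinearPMap.mkSpanSingleton'_apply]
      obtain ⟨s, hs, a, ha, b, hb, hab, h⟩ : t • (p - q) ∈ P := hxP
      by_contra! hneg
      simp at hneg
      refine hqp (aux_scale hE hG hmix ha hb hq hp (k := s / (-t))
        (div_nonneg hs (by linarith)) ?_ hab)
      rw [div_eq_inv_mul, mul_smul, ← h, smul_smul, inv_neg, neg_mul,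
        inv_mul_cancel₀ hneg.ne]
      module) (by
      rintro ⟨_, t, ht, a, ha, b, hb, rfl⟩
      obtain ⟨r, hr0, hr1, hr⟩ := aux_arch hG hcomp hmix hp hq ha hb hqp
      refine ⟨⟨(t / r * (1 - r)) • e, Submodule.mem_span_singleton.2 ⟨_, rfl⟩⟩, ?_⟩
      refine ⟨t / r, by positivity, _, hmix a ha p hp r hr0.le hr1.le, _,
        hmix b hb q hq r hr0.le hr1.le, hr, ?_⟩
      change (t / r * (1 - r)) • (p - q) + t • (a - b) = _
      have : t • (a - b) = (t / r * r) • (a - b) := by rw [div_mul_cancel₀ _ hr0.ne']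
      rw [this]; module)
  have hge : g e = 1 := by
    have := hg1 ⟨e, Submodule.mem_span_singleton_self e⟩
    rw [LinearPMap.mkSpanSingleton_apply] at this
    exact this
  obtain ⟨G, hG'⟩ := LinearMap.exists_extend g
  have hGW : ∀ v (hv : v ∈ W), G v = g ⟨v, hv⟩ := fun v hv => by rw [← hG']; rfl
  have hGP : ∀ a ∈ C, ∀ b ∈ C, R a b → G b ≤ G a := by
    intro a ha b hb hab
    have h := hg2 ⟨a - b, hWd a ha b hb⟩ (hPd a ha b hb hab)
    rw [← hGW, map_sub] at h
    linarith
  have hGe : G p - G q = 1 := by rw [← map_sub, hGW _ e.2]; exact hge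
  refine ⟨G, fun a ha b hb => ⟨hGP a ha b hb, fun h => ?_⟩⟩
  by_contra hab
  obtain ⟨r, hr0, hr1, hr⟩ := aux_arch hG hcomp hmix hb ha hq hp hab
  have := hGP _ (hmix q hq b hb r hr0.le hr1.le) _ (hmix p hp a ha r hr0.le hr1.le) hr
  simp only [map_add, map_smul, smul_eq_mul] at this
  nlinarith

end aux

/-- A relation on a closed, mixture-closed set of AA acts is complete, satisfies extended
mixture cancellation, and has closed graph iff it has an additively separable
representation by a single utility function. -/
theorem complete_extMixCancel_closedGraph_iff_singleUtilityRep
    {S O : Type*} [Fintype S] [Fintype O] [Nonempty S] [Nonempty O]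
    (C : Set (S → O → ℝ)) (R : (S → O → ℝ) → (S → O → ℝ) → Prop)
    (hAA : ∀ a ∈ C, IsAAAct a)
    (hclosedC : IsClosed C)
    (hmix : ∀ a ∈ C, ∀ b ∈ C, ∀ r : ℝ, 0 ≤ r → r ≤ 1 → r • a + (1 - r) • b ∈ C) :
    ((∀ a ∈ C, ∀ b ∈ C, R a b ∨ R b a) ∧ ExtMixCancel C R ∧ ClosedGraphOn C R) ↔
      ∃ u : S → O → ℝ, ∀ a ∈ C, ∀ b ∈ C,
        (R a b ↔ ∑ s, ∑ o, u s o * a s o ≥ ∑ s, ∑ o, u s o * b s o) := by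
  classical
  constructor
  · rintro ⟨hcomp, hE, hG⟩
    obtain ⟨G, h⟩ := aux_main hE hG hcomp hmix
    refine ⟨fun s o => G (Pi.single s (Pi.single o 1)), fun a ha b hb => ?_⟩
    have key : ∀ a : S → O → ℝ, ∑ s, ∑ o, G (Pi.single s (Pi.single o 1)) * a s o = G a := by
      intro a
      have : a = ∑ s, ∑ o, a s o • (Pi.single s (Pi.single o 1) : S → O → ℝ) := by
        ext s o
        simp [Finset.sum_apply, Pi.single_apply, apply_ite, ite_apply]
      conv_rhs => rw [this]
      simp [map_sum, mul_comm]
    rw [key, key]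
    exact h a ha b hb
  · rintro ⟨u, h⟩
    let G : (S → O → ℝ) →ₗ[ℝ] ℝ :=
      { toFun := fun a => ∑ s, ∑ o, u s o * a s o
        map_add' := by intro a b; simp [mul_add, Finset.sum_add_distrib]
        map_smul' := by intro r a; simp [Finset.mul_sum, mul_left_comm] }
    have hGc : Continuous (fun a : S → O → ℝ => ∑ s, ∑ o, u s o * a s o) := by fun_prop
    refine ⟨fun a ha b hb => ?_, aux_conv_emc G h, ?_⟩
    · rw [h a ha b hb, h b hb a ha]; exact le_total _ _
    · have : {p : (S → O → ℝ) × (S → O → ℝ) | p.1 ∈ C ∧ p.2 ∈ C ∧ R p.1 p.2} =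
        (Prod.fst ⁻¹' C ∩ Prod.snd ⁻¹' C) ∩ {p | G p.2 ≤ G p.1} := by
        ext p
        constructor
        · rintro ⟨h1, h2, h3⟩; exact ⟨⟨h1, h2⟩, (h _ h1 _ h2).1 h3⟩
        · rintro ⟨⟨h1, h2⟩, h3⟩; exact ⟨h1, h2, (h _ h1 _ h2).2 h3⟩
      unfold ClosedGraphOn
      rw [this]
      exact ((hclosedC.preimage continuous_fst).inter (hclosedC.preimage continuous_snd)).inter
        (isClosed_le (hGc.comp continuous_snd) (hGc.comp continuous_fst))
end

section
/- A binary relation ⪰ on a set C of Savage acts satisfies extended statewise cancellation if and only if there exists a set U of functions u : S × O → ℝ such that for all a, b ∈ C: a ⪰ b if and only if ∑_{s∈S} u(s, a(s)) ≥ ∑_{s∈S} u(s, b(s)) for every u ∈ U. Moreover, ⪰ additionally satisfies completeness (for all a, b ∈ C, a ⪰ b or b ⪰ a) if and only if U can be chosen to be a singleton. -/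
/-- Extended statewise cancellation for a relation on a set of Savage acts. -/
def ExtStatewiseCancel {S O : Type*} (C : Set (S → O)) (R : (S → O) → (S → O) → Prop) : Prop :=
  ∀ (n : ℕ) (a b : Fin (n + 1) → S → O),
    (∀ i, a i ∈ C) → (∀ i, b i ∈ C) →
    (∀ s : S, ((List.ofFn fun i => a i s : List O) : Multiset O)
            = ((List.ofFn fun i => b i s : List O) : Multiset O)) →
    (∃ k, k ≤ n ∧ (∀ i : Fin (n + 1), (i : ℕ) < k → R (a i) (b i)) ∧
      (∀ i : Fin (n + 1), k ≤ (i : ℕ) → a i = a (Fin.last n) ∧ b i = b (Fin.last n))) →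
    R (b (Fin.last n)) (a (Fin.last n))

theorem bartl_farkas {W ι : Type*} [AddCommGroup W] [Module ℚ W] (s : Finset ι) :
    ∀ (A : ι → W →ₗ[ℚ] ℚ) (g : W →ₗ[ℚ] ℚ),
      (∀ w, (∀ i ∈ s, A i w ≤ 0) → g w ≤ 0) →
      ∃ l : ι → ℚ, (∀ i ∈ s, 0 ≤ l i) ∧ ∀ w, g w = ∑ i ∈ s, l i * A i w := by
  classical
  induction s using Finset.induction_on with
  | empty =>
    intro A g h
    refine ⟨fun _ => 0, by simp, fun w => ?_⟩
    have h1 := h w (by simp)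
    have h2 := h (-w) (by simp)
    simp only [map_neg] at h2
    simp only [Finset.sum_empty]
    linarith
  | insert j s hj ih =>
    intro A g h
    by_cases hc : ∀ w, (∀ i ∈ s, A i w ≤ 0) → g w ≤ 0
    · obtain ⟨l, hl, hg⟩ := ih A g hc
      have hne : ∀ i ∈ s, i ≠ j := fun i hi e => hj (e ▸ hi)
      refine ⟨fun i => if i = j then 0 else l i, fun i hi => ?_, fun w => ?_⟩
      · by_cases e : i = j
        · simp [e]
        · simpa [e] using hl i ((Finset.mem_insert.1 hi).resolve_left e)
      · rw [Finset.sum_insert hj, hg w]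
        simp only [if_true, zero_mul, zero_add]
        exact Finset.sum_congr rfl fun i hi => by simp [hne i hi]
    · push Not at hc
      obtain ⟨w1, hw1, hg1⟩ := hc
      have hpos : 0 < A j w1 := by
        by_contra hn
        push Not at hn
        have := h w1 (fun i hi => by
          rcases Finset.mem_insert.1 hi with rfl | hi
          · exact hn
          · exact hw1 i hi)
        linarith
      obtain ⟨w0, hw0, hg0, hj0⟩ : ∃ w0, (∀ i ∈ s, A i w0 ≤ 0) ∧ 0 < g w0 ∧ A j w0 = 1 := by
        refine ⟨(A j w1)⁻¹ • w1, fun i hi => ?_, ?_, ?_⟩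
        · simp only [map_smul, smul_eq_mul]
          exact mul_nonpos_of_nonneg_of_nonpos (by positivity) (hw1 i hi)
        · simp only [map_smul, smul_eq_mul]
          positivity
        · simp only [map_smul, smul_eq_mul]
          exact inv_mul_cancel₀ hpos.ne'
      obtain ⟨l, hl, hg⟩ := ih (fun i => A i - (A i w0) • A j) (g - (g w0) • A j) (by
        intro w hw
        have := h (w - (A j w) • w0) (fun i hi => by
          rcases Finset.mem_insert.1 hi with rfl | hi
          · simp [hj0]
          · have := hw i hi
            simp only [LinearMap.sub_apply, LinearMap.smul_apply, smul_eq_mul] at this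
            simp only [map_sub, map_smul, smul_eq_mul]
            linarith)
        simp only [map_sub, map_smul, smul_eq_mul] at this
        simp only [LinearMap.sub_apply, LinearMap.smul_apply, smul_eq_mul]
        linarith)
      have hne : ∀ i ∈ s, i ≠ j := fun i hi e => hj (e ▸ hi)
      refine ⟨fun i => if i = j then g w0 - ∑ i ∈ s, l i * A i w0 else l i,
        fun i hi => ?_, fun w => ?_⟩
      · by_cases e : i = j
        · simp only [e, if_true]
          have : ∑ i ∈ s, l i * A i w0 ≤ 0 := Finset.sum_nonpos fun i hi =>
            mul_nonpos_of_nonneg_of_nonpos (hl i hi) (hw0 i hi)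
          linarith
        · simpa [e] using hl i ((Finset.mem_insert.1 hi).resolve_left e)
      · rw [Finset.sum_insert hj]
        have e1 : ∑ i ∈ s, (if i = j then g w0 - ∑ i ∈ s, l i * A i w0 else l i) * A i w
            = ∑ i ∈ s, l i * A i w :=
          Finset.sum_congr rfl fun i hi => by simp [hne i hi]
        have e2 := hg w
        simp only [LinearMap.sub_apply, LinearMap.smul_apply, smul_eq_mul, mul_sub,
          Finset.sum_sub_distrib] at e2
        have e3 : ∑ i ∈ s, l i * (A i w0 * A j w) = (∑ i ∈ s, l i * A i w0) * A j w := by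
          rw [Finset.sum_mul]
          exact Finset.sum_congr rfl fun i _ => by ring
        simp only [if_true]
        rw [e1]
        rw [e3] at e2
        linarith

theorem common_denominator {ι : Type*} (s : Finset ι) (l : ι → ℚ) (hl : ∀ i ∈ s, 0 ≤ l i) :
    ∃ (m : ℕ) (n : ι → ℕ), ∀ i ∈ s, ((m : ℚ) + 1) * l i = n i := by
  have hp : 0 < ∏ i ∈ s, (l i).den := Finset.prod_pos fun i _ => (l i).den_pos
  refine ⟨∏ i ∈ s, (l i).den - 1,
    fun i => ((∏ i ∈ s, (l i).den) / (l i).den) * (l i).num.toNat, fun i hi => ?_⟩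
  have e : (((∏ i ∈ s, (l i).den - 1 : ℕ) : ℚ) + 1) = ((∏ i ∈ s, (l i).den : ℕ) : ℚ) := by
    rw [← Nat.cast_add_one, Nat.sub_add_cancel hp]
  rw [e]
  beta_reduce
  obtain ⟨c, hc⟩ := Finset.dvd_prod_of_mem (fun i => (l i).den) hi
  rw [hc, Nat.mul_div_cancel_left _ (l i).den_pos]
  have h1 : (((l i).num.toNat : ℕ) : ℚ) = ((l i).num : ℚ) := by
    have : (((l i).num.toNat : ℕ) : ℤ) = (l i).num :=
      Int.toNat_of_nonneg (Rat.num_nonneg.2 (hl i hi))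
    exact_mod_cast this
  push_cast
  rw [h1]
  have := Rat.mul_den_eq_num (l i)
  rw [← this]
  ring

theorem cancel_list {S O : Type*} {C : Set (S → O)} {R : (S → O) → (S → O) → Prop}
    (h : ExtStatewiseCancel C R) (L : List ((S → O) × (S → O)))
    (hL : ∀ p ∈ L, p.1 ∈ C ∧ p.2 ∈ C ∧ R p.1 p.2) (m : ℕ) (a b : S → O) (ha : a ∈ C)
    (hb : b ∈ C)
    (he : ∀ s, (((L ++ List.replicate (m + 1) (b, a)).map fun p => p.1 s : List O) : Multiset O)
      = (((L ++ List.replicate (m + 1) (b, a)).map fun p => p.2 s : List O) : Multiset O)) :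
    R a b := by
  set LL := L ++ List.replicate (m + 1) (b, a) with hLL
  have hlen : LL.length = L.length + m + 1 := by simp [hLL]; omega
  have hmem : ∀ p ∈ LL, p.1 ∈ C ∧ p.2 ∈ C := by
    intro p hp
    rcases List.mem_append.1 hp with hp | hp
    · exact ⟨(hL p hp).1, (hL p hp).2.1⟩
    · rw [List.eq_of_mem_replicate hp]
      exact ⟨hb, ha⟩
  have hbig : ∀ (i : ℕ) (hi : i < LL.length), L.length ≤ i → LL[i] = (b, a) := by
    intro i hi hk
    simp only [hLL]
    rw [List.getElem_append_right hk]
    simp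
  have hsmall : ∀ (i : ℕ) (hi : i < LL.length), i < L.length → LL[i] ∈ L := by
    intro i hi hk
    simp only [hLL]
    rw [List.getElem_append_left hk]
    exact List.getElem_mem _
  have hof : ∀ f : (S → O) × (S → O) → O,
      List.ofFn (fun i : Fin (L.length + m + 1) => f (LL[(i : ℕ)]'(by omega))) = LL.map f := by
    intro f
    apply List.ext_getElem
    · simp [hlen]
    · intro i h1 h2
      rw [List.getElem_ofFn, List.getElem_map]
  have key := h (L.length + m) (fun i => (LL[(i : ℕ)]'(by omega)).1)
    (fun i => (LL[(i : ℕ)]'(by omega)).2)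
    (fun i => (hmem _ (List.getElem_mem _)).1) (fun i => (hmem _ (List.getElem_mem _)).2)
    (fun s => by
      have h1 := hof (fun p => p.1 s)
      have h2 := hof (fun p => p.2 s)
      rw [h1, h2]
      exact he s)
    ⟨L.length, by omega, fun i hi => (hL _ (hsmall i (by omega) hi)).2.2, fun i hi => by
      simp only [hbig i (by omega) hi,
        hbig (Fin.last (L.length + m) : Fin _) (by simp [hlen]) (by simp)]
      simp⟩
  simp only [hbig (Fin.last (L.length + m) : Fin _) (by simp [hlen]) (by simp)] at key
  exact key

/-- Evaluation of a utility at an act, as a linear functional. -/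
def evalAct {S O : Type*} [Fintype S] (a : S → O) : (S → O → ℚ) →ₗ[ℚ] ℚ where
  toFun u := ∑ s, u s (a s)
  map_add' u v := by simp [Finset.sum_add_distrib]
  map_smul' c u := by simp [Finset.mul_sum]

theorem rel_of_dominates {S O : Type*} [Fintype S] [Fintype O]
    {C : Set (S → O)} {R : (S → O) → (S → O) → Prop}
    (h : ExtStatewiseCancel C R) (a b : S → O) (ha : a ∈ C) (hb : b ∈ C)
    (hd : ∀ u : S → O → ℚ, (∀ c ∈ C, ∀ d ∈ C, R c d → ∑ s, u s (d s) ≤ ∑ s, u s (c s)) →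
      ∑ s, u s (b s) ≤ ∑ s, u s (a s)) : R a b := by
  classical
  let P : Finset ((S → O) × (S → O)) :=
    Finset.univ.filter fun p => p.1 ∈ C ∧ p.2 ∈ C ∧ R p.1 p.2
  obtain ⟨l, hl, hg⟩ := bartl_farkas P (fun p => evalAct p.2 - evalAct p.1)
    (evalAct b - evalAct a) (by
      intro u hu
      have := hd u (fun c hc d hd' hr => by
        have := hu (c, d) (by simp [P, hc, hd', hr])
        simp only [LinearMap.sub_apply, evalAct, LinearMap.coe_mk, AddHom.coe_mk] at this
        linarith)
      simp only [LinearMap.sub_apply, evalAct, LinearMap.coe_mk, AddHom.coe_mk]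
      linarith)
  obtain ⟨m, n, hn⟩ := common_denominator P l hl
  have hM : ∀ p ∈ ∑ p ∈ P, n p • ({p} : Multiset ((S → O) × (S → O))), p ∈ P := by
    intro p hp
    obtain ⟨q, hq, hpq⟩ := Multiset.mem_sum.1 hp
    have := Multiset.mem_of_mem_nsmul hpq
    rw [Multiset.mem_singleton] at this
    exact this ▸ hq
  refine cancel_list h (∑ p ∈ P, n p • ({p} : Multiset ((S → O) × (S → O)))).toList
    (fun p hp => ?_) m a b ha hb (fun s => ?_)
  · have := hM p (Multiset.mem_toList.1 hp)
    simpa [P] using this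
  · have hmap : ∀ f : (S → O) × (S → O) → O, ∀ o, (Multiset.count o
        ((((∑ p ∈ P, n p • ({p} : Multiset ((S → O) × (S → O)))).toList
          ++ List.replicate (m + 1) (b, a)).map f : List O) : Multiset O) : ℚ)
        = ∑ p ∈ P, (n p : ℚ) * (if f p = o then 1 else 0)
          + ((m : ℚ) + 1) * (if f (b, a) = o then 1 else 0) := by
      intro f o
      rw [← Multiset.map_coe, ← Multiset.coe_add, Multiset.coe_toList, Multiset.map_add,
        Multiset.count_add, Multiset.coe_replicate, Multiset.map_replicate,
        Multiset.count_replicate]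
      have : Multiset.map f (∑ p ∈ P, n p • ({p} : Multiset ((S → O) × (S → O))))
          = ∑ p ∈ P, n p • ({f p} : Multiset O) := by
        rw [← Multiset.coe_mapAddMonoidHom, map_sum]
        simp only [map_nsmul, Multiset.coe_mapAddMonoidHom, Multiset.map_singleton]
      rw [this, Multiset.count_sum']
      push_cast
      congr 1
      · refine Finset.sum_congr rfl fun p _ => ?_
        rw [Multiset.count_nsmul, Multiset.count_singleton]
        simp [eq_comm]
      · split_ifs <;> simp
    ext o
    have := hmap (fun p => p.1 s) o
    have h2 := hmap (fun p => p.2 s) o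
    rw [← Nat.cast_inj (R := ℚ), this, h2]
    have hev : ∀ c : S → O, evalAct c (fun s' o' => if s' = s then (if o' = o then 1 else 0) else 0)
        = if c s = o then 1 else 0 := by
      intro c
      simp [evalAct]
    have e := hg (fun s' o' => if s' = s then (if o' = o then 1 else 0) else 0)
    simp only [LinearMap.sub_apply, hev] at e
    have e2 : ((m : ℚ) + 1) * ((if b s = o then 1 else 0) - (if a s = o then 1 else 0))
        = ∑ p ∈ P, (n p : ℚ) * ((if p.2 s = o then 1 else 0) - (if p.1 s = o then 1 else 0)) := by
      rw [e, Finset.mul_sum]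
      refine Finset.sum_congr rfl fun p hp => ?_
      rw [← hn p hp]
      ring
    simp only [mul_sub, Finset.sum_sub_distrib] at e2
    linarith

theorem cancel_of_rep {S O : Type*} [Fintype S]
    (C : Set (S → O)) (R : (S → O) → (S → O) → Prop) (U : Set (S → O → ℝ))
    (hU : ∀ a ∈ C, ∀ b ∈ C, (R a b ↔ ∀ u ∈ U, ∑ s, u s (a s) ≥ ∑ s, u s (b s))) :
    ExtStatewiseCancel C R := by
  rintro n a b ha hb he ⟨k, hk, hR, hc⟩
  rw [hU _ (hb _) _ (ha _)]
  intro u hu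
  by_contra hlt
  push Not at hlt
  have hsum : ∑ i, ∑ s, u s (a i s) = ∑ i, ∑ s, u s (b i s) := by
    rw [Finset.sum_comm, Finset.sum_comm (f := fun i s => u s (b i s))]
    refine Finset.sum_congr rfl fun s _ => ?_
    have := congrArg (fun M => (Multiset.map (u s) M).sum) (he s)
    simpa only [Multiset.map_coe, Multiset.sum_coe, List.map_ofFn, List.sum_ofFn,
      Function.comp_apply] using this
  have : ∑ i, ∑ s, u s (b i s) < ∑ i, ∑ s, u s (a i s) := by
    refine Finset.sum_lt_sum (fun i _ => ?_) ⟨Fin.last n, Finset.mem_univ _, hlt⟩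
    by_cases hi : (i : ℕ) < k
    · exact (hU _ (ha i) _ (hb i)).1 (hR i hi) u hu
    · rw [(hc i (not_lt.1 hi)).1, (hc i (not_lt.1 hi)).2]
      exact hlt.le
  linarith

theorem rep_of_cancel {S O : Type*} [Fintype S] [Fintype O]
    (C : Set (S → O)) (R : (S → O) → (S → O) → Prop) (h : ExtStatewiseCancel C R) :
    ∃ U : Set (S → O → ℝ), ∀ a ∈ C, ∀ b ∈ C,
        (R a b ↔ ∀ u ∈ U, ∑ s, u s (a s) ≥ ∑ s, u s (b s)) := by
  refine ⟨{u | ∀ c ∈ C, ∀ d ∈ C, R c d → ∑ s, u s (d s) ≤ ∑ s, u s (c s)},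
    fun a ha b hb => ⟨fun hr u hu => hu a ha b hb hr, fun hall => ?_⟩⟩
  refine rel_of_dominates h a b ha hb fun u hu => ?_
  have := hall (fun s o => (u s o : ℝ)) (fun c hc d hd hr => by
    beta_reduce
    exact_mod_cast hu c hc d hd hr)
  exact_mod_cast this

theorem singleton_of_complete {S O : Type*} [Fintype S] [Fintype O]
    (C : Set (S → O)) (R : (S → O) → (S → O) → Prop) (U : Set (S → O → ℝ))
    (hU : ∀ a ∈ C, ∀ b ∈ C, (R a b ↔ ∀ u ∈ U, ∑ s, u s (a s) ≥ ∑ s, u s (b s)))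
    (hc : ∀ a ∈ C, ∀ b ∈ C, R a b ∨ R b a) :
    ∃ u : S → O → ℝ, ∀ a ∈ C, ∀ b ∈ C,
        (R a b ↔ ∑ s, u s (a s) ≥ ∑ s, u s (b s)) := by
  classical
  let P : Finset ((S → O) × (S → O)) :=
    Finset.univ.filter fun p => p.1 ∈ C ∧ p.2 ∈ C ∧ ¬ R p.1 p.2
  have hex : ∀ p : (S → O) × (S → O), ∃ u : S → O → ℝ, p ∈ P →
      u ∈ U ∧ ∑ s, u s (p.1 s) < ∑ s, u s (p.2 s) := by
    intro p
    by_cases hp : p ∈ P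
    · have hp' : p.1 ∈ C ∧ p.2 ∈ C ∧ ¬ R p.1 p.2 := by simpa [P] using hp
      have := hp'.2.2
      rw [hU _ hp'.1 _ hp'.2.1] at this
      push Not at this
      obtain ⟨u, hu, hlt⟩ := this
      exact ⟨u, fun _ => ⟨hu, hlt⟩⟩
    · exact ⟨0, fun h => absurd h hp⟩
  choose v hv using hex
  have hsum : ∀ c : S → O, ∑ s, (∑ p ∈ P, v p) s (c s) = ∑ p ∈ P, ∑ s, v p s (c s) := by
    intro c
    rw [Finset.sum_comm]
    simp [Finset.sum_apply]
  refine ⟨∑ p ∈ P, v p, fun a ha b hb => ⟨fun hr => ?_, fun hge => ?_⟩⟩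
  · rw [hsum, hsum]
    exact Finset.sum_le_sum fun p hp => (hU a ha b hb).1 hr _ (hv p hp).1
  · by_contra hn
    have hr := (hc a ha b hb).resolve_left hn
    have hlt : ∑ p ∈ P, ∑ s, v p s (a s) < ∑ p ∈ P, ∑ s, v p s (b s) := by
      have hm : (a, b) ∈ P := by simp [P, ha, hb, hn]
      exact Finset.sum_lt_sum (fun p hp => (hU b hb a ha).1 hr _ (hv p hp).1)
        ⟨(a, b), hm, (hv _ hm).2⟩
    rw [hsum, hsum] at hge
    linarith


/-- A relation on a set of Savage acts satisfies extended statewise cancellation iff it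
has an additively separable (state-dependent) multi-utility representation; and it is in
addition complete iff the representing set of utilities can be chosen to be a singleton. -/
theorem extStatewiseCancel_iff_multiUtilityRep_and_complete_iff_singleton
    {S O : Type*} [Fintype S] [Fintype O] [Nonempty S] [Nonempty O]
    (C : Set (S → O)) (R : (S → O) → (S → O) → Prop) :
    (ExtStatewiseCancel C R ↔
      ∃ U : Set (S → O → ℝ), ∀ a ∈ C, ∀ b ∈ C,
        (R a b ↔ ∀ u ∈ U, ∑ s, u s (a s) ≥ ∑ s, u s (b s))) ∧
    ((ExtStatewiseCancel C R ∧ (∀ a ∈ C, ∀ b ∈ C, R a b ∨ R b a)) ↔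
      ∃ u : S → O → ℝ, ∀ a ∈ C, ∀ b ∈ C,
        (R a b ↔ ∑ s, u s (a s) ≥ ∑ s, u s (b s))) := by
  refine ⟨⟨rep_of_cancel C R, fun ⟨U, hU⟩ => cancel_of_rep C R U hU⟩, Iff.intro ?_ ?_⟩
  · rintro ⟨h, hc⟩
    obtain ⟨U, hU⟩ := rep_of_cancel C R h
    exact singleton_of_complete C R U hU hc
  · rintro ⟨u, hu⟩
    refine ⟨cancel_of_rep C R {u} (fun a ha b hb => by simpa using hu a ha b hb), ?_⟩
    intro a ha b hb
    rw [hu a ha b hb, hu b hb a ha]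
    exact le_total _ _
end
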